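/- For every integer n ≥ 3, the polynomials q_1, q_2, …, q_{n−2} are linearly independent and form a basis of the space W^{(n)} = { v : v is a real polynomial of degree at most n, v'(1) = v'(−1) = 0, and ∫_{−1}^{1} v(x) dx = 0 }. -/

import Mathlib

open MeasureTheory intervalIntegral

/-- Normalized Legendre polynomial on `[-1,1]`:
`p_n(x) = √(n + 1/2) · (1/(2ⁿ n!)) · (d/dx)ⁿ (x² − 1)ⁿ`, so `∫_{-1}^1 p_m p_n = δ_{mn}`. -/
noncomputable def legP (n : ℕ) (x : ℝ) : ℝ :=
  Real.sqrt ((n : ℝ) + 1/2) * (1 / ((2:ℝ)^n * (Nat.factorial n : ℝ))) *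
    iteratedDeriv n (fun y : ℝ => (y^2 - 1)^n) x

/-- `β_j = j(j+1)√(2j+1) / ((j+2)(j+3)√(2j+5))`. -/
noncomputable def betaC (j : ℕ) : ℝ :=
  ((j:ℝ) * ((j:ℝ) + 1) * Real.sqrt (2*(j:ℝ) + 1)) /
    (((j:ℝ) + 2) * ((j:ℝ) + 3) * Real.sqrt (2*(j:ℝ) + 5))

/-- `α_j = √(1 + β_j²)`. -/
noncomputable def alphaC (j : ℕ) : ℝ := Real.sqrt (1 + (betaC j)^2)

/-- `q_j = (p_j − β_j p_{j+2}) / α_j`. -/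
noncomputable def qP (j : ℕ) (x : ℝ) : ℝ := (legP j x - betaC j * legP (j+2) x) / alphaC j

/-- The space `W⁽ⁿ⁾` of real polynomial functions of degree at most `n` with
`v'(1) = v'(−1) = 0` and `∫_{−1}^{1} v = 0`. -/
def Wspace (n : ℕ) : Set (ℝ → ℝ) :=
  {v | (∃ P : Polynomial ℝ, P.natDegree ≤ n ∧ ∀ x, v x = P.eval x) ∧
    deriv v 1 = 0 ∧ deriv v (-1) = 0 ∧ (∫ x in (-1:ℝ)..1, v x) = 0}

section Legendre

open Polynomial

/-- `legP n` as a polynomial. -/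
noncomputable def legPoly (n : ℕ) : ℝ[X] :=
  C (√((n : ℝ) + 1/2) * (1 / ((2:ℝ)^n * (Nat.factorial n : ℝ)))) *
    derivative^[n] ((X ^ 2 - 1) ^ n)

/-- `qP j` as a polynomial. -/
noncomputable def qPoly (j : ℕ) : ℝ[X] :=
  C (alphaC j)⁻¹ * (legPoly j - C (betaC j) * legPoly (j + 2))

/-- The linear map sending a polynomial to the function it defines. -/
noncomputable def evalFun : ℝ[X] →ₗ[ℝ] (ℝ → ℝ) := LinearMap.pi fun x => leval x

lemma evalFun_apply (P : ℝ[X]) (x : ℝ) : evalFun P x = P.eval x := rfl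

lemma evalFun_injective : Function.Injective evalFun := fun _ _ h =>
  Polynomial.funext fun x => congrFun h x

lemma iteratedDeriv_eval (P : ℝ[X]) (n : ℕ) (x : ℝ) :
    iteratedDeriv n (fun y => P.eval y) x = (derivative^[n] P).eval x := by
  induction n generalizing x with
  | zero => simp
  | succ n ih =>
    rw [iteratedDeriv_succ, _root_.funext ih, Polynomial.deriv, Function.iterate_succ_apply']

lemma evalFun_legPoly (n : ℕ) : evalFun (legPoly n) = legP n := by
  ext x
  rw [evalFun_apply, legPoly, eval_mul, eval_C, ← iteratedDeriv_eval, legP]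
  simp

lemma evalFun_qPoly (j : ℕ) : evalFun (qPoly j) = qP j := by
  ext x
  have h (n : ℕ) : (legPoly n).eval x = legP n x := congrFun (evalFun_legPoly n) x
  rw [evalFun_apply, qPoly, qP]
  simp only [eval_mul, eval_C, eval_sub, h]
  ring

lemma eval_iterate_derivative_eq_taylor_coeff (P : ℝ[X]) (k : ℕ) (a : ℝ) :
    (derivative^[k] P).eval a = (k.factorial : ℝ) * (taylor a P).coeff k := by
  rw [← factorial_smul_hasseDeriv, taylor_coeff]
  simp

lemma taylor_X_sq_sub_one_pow {a : ℝ} (ha : a ^ 2 = 1) (n : ℕ) :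
    taylor a ((X ^ 2 - 1) ^ n : ℝ[X]) = X ^ n * (X + C (2 * a)) ^ n := by
  have h : (C a : ℝ[X]) ^ 2 = 1 := by rw [← C_pow, ha, C_1]
  rw [taylor_pow, ← mul_pow]
  congr 1
  simp only [taylor_apply, sub_comp, pow_comp, X_comp, one_comp, C_mul]
  rw [show (C 2 : ℝ[X]) = 2 from rfl]
  linear_combination h

lemma derivative_legPoly_eval {a : ℝ} (ha : a ^ 2 = 1) (n : ℕ) :
    (derivative (legPoly n)).eval a = √((n : ℝ) + 1/2) * (n * (n + 1) / 2) * a ^ (n + 1) := by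
  rw [legPoly, derivative_C_mul, eval_mul, eval_C,
    ← Function.iterate_succ_apply' derivative,
    eval_iterate_derivative_eq_taylor_coeff, taylor_X_sq_sub_one_pow ha, Nat.succ_eq_add_one,
    add_comm n 1, coeff_X_pow_mul, coeff_X_add_C_pow]
  rcases n with _ | n
  · simp
  have h : a ^ (1 + (n + 1)) = a ^ n := by
    rw [show 1 + (n + 1) = n + 2 by ring, pow_add, ha, mul_one]
  have hf : ((n + 1).factorial : ℝ) ≠ 0 := by positivity
  rw [h, add_comm 1 (n + 1), Nat.factorial_succ (n + 1)]
  simp only [Nat.add_sub_cancel, Nat.choose_one_right, mul_pow]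
  push_cast
  field_simp
  ring

lemma integral_legPoly {n : ℕ} (hn : 1 ≤ n) : ∫ x in (-1:ℝ)..1, (legPoly n).eval x = 0 := by
  obtain ⟨n, rfl⟩ := Nat.exists_eq_add_of_le' hn
  have hz {a : ℝ} (ha : a ^ 2 = 1) :
      (derivative^[n] ((X ^ 2 - 1) ^ (n + 1) : ℝ[X])).eval a = 0 := by
    rw [eval_iterate_derivative_eq_taylor_coeff, taylor_X_sq_sub_one_pow ha, coeff_X_pow_mul']
    simp
  simp only [legPoly, eval_mul, eval_C, intervalIntegral.integral_const_mul,
    Function.iterate_succ_apply']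
  rw [intervalIntegral.integral_eq_sub_of_hasDerivAt (fun x _ => Polynomial.hasDerivAt _ x)
    ((Polynomial.continuous _).intervalIntegrable _ _), hz (by norm_num), hz (by norm_num)]
  simp

lemma natDegree_X_sq_sub_one_pow (n : ℕ) : ((X ^ 2 - 1 : ℝ[X]) ^ n).natDegree = n * 2 := by
  rw [natDegree_pow, ← C_1, natDegree_X_pow_sub_C]

lemma natDegree_legPoly (n : ℕ) : (legPoly n).natDegree = n := by
  have hm : ((X ^ 2 - 1 : ℝ[X]) ^ n).Monic := by
    rw [← C_1]; exact (monic_X_pow_sub_C 1 two_ne_zero).pow n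
  rw [legPoly, natDegree_C_mul (by positivity)]
  apply natDegree_eq_of_le_of_coeff_ne_zero
  · refine (natDegree_iterate_derivative _ _).trans ?_
    rw [natDegree_X_sq_sub_one_pow]
    omega
  · have h1 : ((X ^ 2 - 1 : ℝ[X]) ^ n).coeff (n + n) = 1 := by
      rw [← mul_two, ← natDegree_X_sq_sub_one_pow n]
      exact hm.coeff_natDegree
    rw [coeff_iterate_derivative, h1]
    simp [Nat.descFactorial_eq_zero_iff_lt]

lemma betaC_pos {j : ℕ} (hj : 1 ≤ j) : 0 < betaC j := by
  have : (0:ℝ) < j := by exact_mod_cast hj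
  unfold betaC
  positivity

lemma alphaC_pos (j : ℕ) : 0 < alphaC j := by
  unfold alphaC
  positivity

lemma natDegree_qPoly {j : ℕ} (hj : 1 ≤ j) : (qPoly j).natDegree = j + 2 := by
  have h : (C (betaC j) * legPoly (j + 2)).natDegree = j + 2 := by
    rw [natDegree_C_mul (betaC_pos hj).ne', natDegree_legPoly]
  rw [qPoly, natDegree_C_mul (inv_ne_zero (alphaC_pos j).ne'),
    natDegree_sub_eq_right_of_natDegree_lt, h]
  rw [h, natDegree_legPoly]
  omega

lemma derivative_qPoly_eval {a : ℝ} (ha : a ^ 2 = 1) (j : ℕ) :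
    (derivative (qPoly j)).eval a = 0 := by
  have h1 : √((j : ℝ) + 1/2) = √(2 * (j : ℝ) + 1) / √2 := by
    rw [← Real.sqrt_div' _ zero_le_two]; congr 1; ring
  have h2 : √(((j + 2 : ℕ) : ℝ) + 1/2) = √(2 * (j : ℝ) + 5) / √2 := by
    rw [← Real.sqrt_div' _ zero_le_two]; congr 1; push_cast; ring
  have h3 : a ^ (j + 2 + 1) = a ^ (j + 1) := by
    rw [show j + 2 + 1 = j + 1 + 2 by ring, pow_add, ha, mul_one]
  rw [qPoly, derivative_C_mul, derivative_sub, derivative_C_mul, eval_mul, eval_sub, eval_mul,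
    derivative_legPoly_eval ha, derivative_legPoly_eval ha, eval_C, eval_C, h1, h2, h3, betaC]
  have h4 : √(2 * (j : ℝ) + 5) ≠ 0 := by positivity
  push_cast
  field_simp
  ring

lemma intervalIntegrable_eval (P : ℝ[X]) (a b : ℝ) :
    IntervalIntegrable (fun x => P.eval x) volume a b :=
  P.continuous.intervalIntegrable a b

lemma integral_qPoly {j : ℕ} (hj : 1 ≤ j) : ∫ x in (-1:ℝ)..1, (qPoly j).eval x = 0 := by
  simp only [qPoly, eval_mul, eval_C, eval_sub, intervalIntegral.integral_const_mul]
  rw [intervalIntegral.integral_sub (intervalIntegrable_eval _ _ _)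
    ((intervalIntegrable_eval _ _ _).const_mul _), intervalIntegral.integral_const_mul,
    integral_legPoly hj, integral_legPoly (by omega)]
  simp

/-- The polynomials of degree at most `n` whose functions lie in `Wspace n`. -/
noncomputable def Wpoly (n : ℕ) : Submodule ℝ ℝ[X] where
  carrier := {P | P.natDegree ≤ n ∧ (derivative P).eval 1 = 0 ∧ (derivative P).eval (-1) = 0 ∧
    ∫ x in (-1:ℝ)..1, P.eval x = 0}
  zero_mem' := by simp
  add_mem' := by
    rintro P Q ⟨hP, hP1, hP2, hP3⟩ ⟨hQ, hQ1, hQ2, hQ3⟩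
    refine ⟨natDegree_add_le_of_degree_le hP hQ, by simp [hP1, hQ1], by simp [hP2, hQ2], ?_⟩
    simp only [eval_add]
    rw [intervalIntegral.integral_add (intervalIntegrable_eval _ _ _)
      (intervalIntegrable_eval _ _ _), hP3, hQ3, add_zero]
  smul_mem' := by
    rintro c P ⟨hP, hP1, hP2, hP3⟩
    refine ⟨(natDegree_smul_le c P).trans hP, by simp [hP1], by simp [hP2], ?_⟩
    simp only [eval_smul, smul_eq_mul, intervalIntegral.integral_const_mul, hP3, mul_zero]

lemma mem_Wpoly {n : ℕ} {P : ℝ[X]} : P ∈ Wpoly n ↔ P.natDegree ≤ n ∧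
    (derivative P).eval 1 = 0 ∧ (derivative P).eval (-1) = 0 ∧
    ∫ x in (-1:ℝ)..1, P.eval x = 0 := Iff.rfl

lemma qPoly_mem_Wpoly {j n : ℕ} (hj : 1 ≤ j) (hn : j + 2 ≤ n) : qPoly j ∈ Wpoly n :=
  ⟨(natDegree_qPoly hj).trans_le hn, derivative_qPoly_eval (by norm_num) j,
    derivative_qPoly_eval (by norm_num) j, integral_qPoly hj⟩

lemma Wspace_eq_map (n : ℕ) : Wspace n = (Wpoly n).map evalFun := by
  ext v
  constructor
  · rintro ⟨⟨P, hP, hv⟩, h1, h2, h3⟩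
    obtain rfl : v = fun x => P.eval x := _root_.funext hv
    rw [Polynomial.deriv] at h1 h2
    exact ⟨P, ⟨hP, h1, h2, h3⟩, rfl⟩
  · rintro ⟨P, ⟨hP, h1, h2, h3⟩, rfl⟩
    rw [← Polynomial.deriv] at h1 h2
    exact ⟨⟨P, hP, fun _ => rfl⟩, h1, h2, h3⟩

lemma Wpoly_two : Wpoly 2 = ⊥ := by
  refine (Submodule.eq_bot_iff _).2 fun P hP => ?_
  obtain ⟨hd, h1, h2, h3⟩ := mem_Wpoly.1 hP
  have hs := P.as_sum_range_C_mul_X_pow' (Nat.lt_succ_of_le hd)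
  generalize P.coeff = c at hs
  simp only [Finset.sum_range_succ, Finset.sum_range_zero] at hs
  subst hs
  simp at h1 h2
  have hb : c 1 = 0 := by linarith
  have hc : c 2 = 0 := by linarith
  simp [hb, hc] at h3
  have ha : c 0 = 0 := by linarith
  simp [ha, hb, hc]

lemma Wpoly_le_span (m : ℕ) :
    Wpoly (m + 2) ≤ Submodule.span ℝ (Set.range fun j : Fin m => qPoly ((j : ℕ) + 1)) := by
  induction m with
  | zero => simp [Wpoly_two]
  | succ m ih =>
    intro P hP
    have hq : (qPoly (m + 1)).natDegree = m + 3 := natDegree_qPoly (by omega)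
    have hl : (qPoly (m + 1)).coeff (m + 3) ≠ 0 := by
      rw [← hq, coeff_natDegree, leadingCoeff_ne_zero]
      intro h
      simp [h] at hq
    set c := P.coeff (m + 3) / (qPoly (m + 1)).coeff (m + 3) with hc
    have hR := (Wpoly (m + 3)).sub_mem hP
      ((Wpoly (m + 3)).smul_mem c (qPoly_mem_Wpoly (j := m + 1) (by omega) le_rfl))
    have hR' : P - c • qPoly (m + 1) ∈ Wpoly (m + 2) := by
      refine ⟨?_, hR.2⟩
      refine natDegree_le_pred (n := m + 3) hR.1 ?_
      rw [coeff_sub, coeff_smul, smul_eq_mul, hc, div_mul_cancel₀ _ hl, sub_self]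
    rw [← sub_add_cancel P (c • qPoly (m + 1))]
    refine Submodule.add_mem _ (Submodule.span_mono ?_ (ih hR'))
      (Submodule.smul_mem _ _ (Submodule.subset_span ⟨Fin.last m, by simp⟩))
    rintro _ ⟨j, rfl⟩
    exact ⟨j.castSucc, by simp⟩

lemma span_qPoly_eq_Wpoly (m : ℕ) :
    Submodule.span ℝ (Set.range fun j : Fin m => qPoly ((j : ℕ) + 1)) = Wpoly (m + 2) := by
  refine le_antisymm (Submodule.span_le.2 ?_) (Wpoly_le_span m)
  rintro _ ⟨j, rfl⟩
  exact qPoly_mem_Wpoly (by omega) (by omega)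

/-- The polynomials `qPoly j`, `j ≥ 1`, completed to a sequence with one polynomial per degree. -/
noncomputable def qSequence : Polynomial.Sequence ℝ where
  elems' i := if i < 3 then X ^ i else qPoly (i - 2)
  degree_eq' i := by
    split_ifs with h
    · simp
    · have hq : (qPoly (i - 2)).natDegree = i := by
        rw [natDegree_qPoly (by omega)]; omega
      rw [degree_eq_iff_natDegree_eq_of_pos (by omega), hq]

lemma linearIndependent_qPoly (m : ℕ) :
    LinearIndependent ℝ fun j : Fin m => qPoly ((j : ℕ) + 1) := by
  have h := qSequence.linearIndependent.comp (fun j : Fin m => (j : ℕ) + 3)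
    fun i j hij => Fin.ext (by simpa using hij)
  have hq : (fun j : Fin m => qPoly ((j : ℕ) + 1)) = qSequence ∘ fun j : Fin m => (j : ℕ) + 3 := by
    ext1 j
    exact (if_neg (c := (j : ℕ) + 3 < 3) (t := X ^ ((j : ℕ) + 3)) (by omega)).symm
  rw [hq]
  exact h

end Legendre

/-- for every `n ≥ 3`, the polynomials `q_1, …, q_{n−2}` are linearly independent
and form a basis of `W⁽ⁿ⁾` (i.e. their span is exactly `W⁽ⁿ⁾`). -/
theorem qP_basis_of_Wspace (n : ℕ) (hn : 3 ≤ n) :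
    LinearIndependent ℝ (fun j : Fin (n - 2) => qP ((j : ℕ) + 1)) ∧
      (Submodule.span ℝ (Set.range fun j : Fin (n - 2) => qP ((j : ℕ) + 1)) : Set (ℝ → ℝ)) =
        Wspace n := by
  obtain ⟨m, rfl⟩ : ∃ m, n = m + 2 := ⟨n - 2, by omega⟩
  rw [Nat.add_sub_cancel]
  have hf : (fun j : Fin m => qP ((j : ℕ) + 1)) = evalFun ∘ fun j : Fin m => qPoly ((j : ℕ) + 1) :=
    _root_.funext fun j => (evalFun_qPoly _).symm
  rw [hf]
  refine ⟨(linearIndependent_qPoly m).map' _ (LinearMap.ker_eq_bot.2 evalFun_injective), ?_⟩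
  rw [Set.range_comp, Submodule.span_image, span_qPoly_eq_Wpoly, Wspace_eq_map]
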